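/- arXiv:1402.6873 — 2 statements merged into one kernel-verified Lean document; each statement's English description precedes it below -/
import Mathlib

section
/- Suppose k is odd and s is a rational number with [m_1, …, m_{k−1}, m_k−1, 2] ≤ s < [m_1, …, m_{k−1}, m_k−1]. Then CS(s) contains (m, S_{1e}, S_2, S_1, S_2, S_{1b}, m) as a subsequence. -/
/- Formalization of statements from "Homotopically equivalent simple loops on
2-bridge spheres in Heckoid orbifolds for 2-bridge links (II)" by Lee-Sakuma.

We work in the free group `F` on two generators `a = gen 0`, `b = gen 1`.
For a rational `s` (in lowest terms `q/p`, with `0 ≤ s ≤ 1`), `uWord s` is the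
word `u_s = a b^{ε₁} a^{ε₂} ⋯ b^{ε_{2p-1}}` with `ε_i = (-1)^⌊i·s⌋`.
`CS s` is (a linear representative of) the cyclic sequence of lengths of
maximal constant-sign runs of exponents of `u_s`; since `u_s` begins with a
positive letter and (for `0 < s ≤ 1`) ends with a negative letter, the linear
run-length sequence represents the cyclic one.  `CyclicContains L T` says the
cyclic sequence represented by `L` contains `T` as a block of consecutive
terms.  `cfQ [m₁,…,m_k]` is the continued fraction `1/(m₁+1/(m₂+⋯+1/m_k))`.
`memI1 M n s` / `memI2 M n s` express `s ∈ I₁(r;n)` / `s ∈ I₂(r;n)` where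
`r = cfQ M`, and `memI1hat` / `memI2hat` express `s ∈ I₁(r)` / `s ∈ I₂(r)`.
The Heckoid group `Heck(r;n) = ⟨a,b | u_r^n⟩` is the quotient of `F` by the
normal closure `heckN r n` of `u_r^n`, with quotient map `heckQ r n`. -/

namespace Heckoid

abbrev F : Type := FreeGroup (Fin 2)

/-- The generators: `gen 0 = a`, `gen 1 = b` (and `gen i` depends on parity). -/
def gen (i : ℕ) : F := FreeGroup.of ⟨i % 2, Nat.mod_lt _ (by norm_num)⟩

/-- The word `u_s = a b^{ε₁} a^{ε₂} b^{ε₃} ⋯ a^{ε_{2p-2}} b^{ε_{2p-1}}`,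
where `s = q/p` in lowest terms and `ε_i = (-1)^⌊iq/p⌋`. -/
def uWord (s : ℚ) : F :=
  ((List.range (2 * s.den)).map
    (fun i => gen i ^ ((-1 : ℤ) ^ (⌊(i : ℚ) * s⌋.toNat)))).prod

/-- The sequence of exponent signs `ε₀, ε₁, …, ε_{2p-1}` of `u_s`. -/
def signList (s : ℚ) : List ℤ :=
  (List.range (2 * s.den)).map (fun i => (-1 : ℤ) ^ (⌊(i : ℚ) * s⌋.toNat))

/-- Lengths of the maximal runs of equal consecutive entries. -/
def runLengths {α : Type} [BEq α] (l : List α) : List ℕ :=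
  (l.splitBy (· == ·)).map List.length

/-- `CS s = CS(u_s)`: the cyclic sequence of lengths of maximal constant-sign
runs of `u_s`, represented by a list. -/
def CS (s : ℚ) : List ℕ := runLengths (signList s)

/-- The cyclic sequence represented by `L` contains `T` as a block of
consecutive terms. -/
def CyclicContains (L T : List ℕ) : Prop := ∃ k, T <+: L.rotate k

/-- The continued fraction `[m₁, m₂, …, m_k] = 1/(m₁+1/(m₂+⋯+1/m_k))`. -/
def cfQ : List ℕ → ℚ
  | [] => 0
  | a :: l => 1 / ((a : ℚ) + cfQ l)

/-- `d⟨T, T'⟩`: `d` consecutive repetitions of the concatenation of `T` and `T'`. -/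
def rep2 (d : ℕ) (T T' : List ℕ) : List ℕ := (List.replicate d (T ++ T')).flatten

/-- `s ∈ I₁(r;n)` where `r = cfQ M`:  `[0, [m₁,…,m_{k-1},m_k-1,2]]` for `k` even,
`[0, [m₁,…,m_k,2n-2])` for `k` odd. -/
def memI1 (M : List ℕ) (n : ℕ) (s : ℚ) : Prop :=
  if Even M.length then 0 ≤ s ∧ s ≤ cfQ (M.dropLast ++ [M.getLast! - 1, 2])
  else 0 ≤ s ∧ s < cfQ (M ++ [2 * n - 2])

/-- `s ∈ I₂(r;n)` where `r = cfQ M`: `([m₁,…,m_k,2n-2], 1]` for `k` even,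
`[[m₁,…,m_{k-1},m_k-1,2], 1]` for `k` odd. -/
def memI2 (M : List ℕ) (n : ℕ) (s : ℚ) : Prop :=
  if Even M.length then cfQ (M ++ [2 * n - 2]) < s ∧ s ≤ 1
  else cfQ (M.dropLast ++ [M.getLast! - 1, 2]) ≤ s ∧ s ≤ 1

/-- `s ∈ I₁(r)` where `r = cfQ M`. -/
def memI1hat (M : List ℕ) (s : ℚ) : Prop :=
  if Even M.length then 0 ≤ s ∧ s ≤ cfQ (M.dropLast ++ [M.getLast! - 1])
  else 0 ≤ s ∧ s ≤ cfQ M.dropLast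

/-- `s ∈ I₂(r)` where `r = cfQ M`. -/
def memI2hat (M : List ℕ) (s : ℚ) : Prop :=
  if Even M.length then cfQ M.dropLast ≤ s ∧ s ≤ 1
  else cfQ (M.dropLast ++ [M.getLast! - 1]) ≤ s ∧ s ≤ 1

theorem cfQ_nonneg (l : List ℕ) : 0 ≤ cfQ l := by
  induction l with
  | nil => exact le_rfl
  | cons a l ih => unfold cfQ; positivity

theorem cfQ_le_one {l : List ℕ} (hl : ∀ x ∈ l, 0 < x) : cfQ l ≤ 1 := by
  cases l with
  | nil => simp [cfQ]
  | cons a l =>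
    have ha : (1 : ℚ) ≤ a := by exact_mod_cast hl a (by simp)
    have := cfQ_nonneg l
    rw [cfQ, div_le_one (by positivity)]
    linarith

/-- Prepending the terms `L` to a continued fraction acts by a Möbius transformation with
natural coefficients and determinant `±1`. -/
theorem exists_cfQ_append_eq (L : List ℕ) (hL : ∀ x ∈ L, 0 < x) :
    ∃ a b c d : ℕ, 0 < c ∧ (b * c - a * d : ℤ) = (-1) ^ L.length ∧
      ∀ T, cfQ (L ++ T) = (a + b * cfQ T) / (c + d * cfQ T) := by
  induction L with
  | nil => exact ⟨0, 1, 1, 0, one_pos, by simp, fun T => by simp⟩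
  | cons m L ih =>
    obtain ⟨a, b, c, d, hc, hdet, hT⟩ := ih fun x hx => hL x (by simp [hx])
    have hm : 0 < m := hL m (by simp)
    refine ⟨c, d, m * c + a, m * d + b, by positivity, ?_, fun T => ?_⟩
    · push_cast
      rw [List.length_cons, pow_succ, ← hdet]
      ring
    · have h0 := cfQ_nonneg T
      have hc' : (0 : ℚ) < c := by exact_mod_cast hc
      have hm' : (0 : ℚ) < m := by exact_mod_cast hm
      have h1 : (0 : ℚ) < c + d * cfQ T := by positivity
      rw [List.cons_append, cfQ, hT]
      push_cast
      have h2 : (0 : ℚ) < m * c + a + (m * d + b) * cfQ T := by positivity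
      have h3 : (0 : ℚ) < m + (a + b * cfQ T) / (c + d * cfQ T) := by positivity
      rw [div_eq_div_iff h3.ne' h2.ne']
      field_simp
      ring

/-- For an odd number of terms, `[…, k - 1]` is the Farey neighbour of `[…, k]` from above,
and `[…, k - 1, 2]` is the mediant of the two. -/
theorem exists_farey_neighbour (L : List ℕ) (hL : ∀ x ∈ L, 0 < x) (hLe : Even L.length)
    {k : ℕ} (hk : 2 ≤ k) :
    ∃ p q g h : ℤ, 0 < p ∧ 0 < g ∧ 0 < h ∧ h ≤ q ∧ h * p - g * q = 1 ∧
      cfQ (L ++ [k]) = q / p ∧ cfQ (L ++ [k - 1]) = h / g ∧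
      cfQ (L ++ [k - 1, 2]) = (h + q) / (g + p) := by
  obtain ⟨a, b, c, d, hc, hdet, hT⟩ := exists_cfQ_append_eq L hL
  rw [hLe.neg_one_pow] at hdet
  obtain ⟨j, rfl⟩ : ∃ j, k = j + 1 := ⟨k - 1, by omega⟩
  have hj : 0 < j := by omega
  have hb : 0 < b := by
    rcases Nat.eq_zero_or_pos b with rfl | hb
    · have : (0 : ℤ) ≤ a * d := by positivity
      simp at hdet
      omega
    · exact hb
  have hcq : (0 : ℚ) < c := by exact_mod_cast hc
  have hjq : (0 : ℚ) < j := by exact_mod_cast hj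
  refine ⟨c * (j + 1) + d, a * (j + 1) + b, c * j + d, a * j + b, by positivity, by positivity,
    by positivity, ?_, ?_, ?_, ?_, ?_⟩
  · have : (0 : ℤ) ≤ a := by positivity
    linarith
  · linear_combination hdet
  all_goals
    rw [hT]
    simp only [cfQ, Nat.add_sub_cancel]
    push_cast
    rw [div_eq_div_iff (by positivity) (by positivity)]
    field_simp
    try ring

/-- Lines through the origin whose slopes are separated by no fraction of small denominator
have the same ceilings near the origin. -/
theorem ceil_mul_eq_of_farey {p q g h : ℤ} (hq : 0 < q) (hh : 0 < h) (hdet : h * p - g * q = 1)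
    {y : ℚ} (hy1 : g < h * y) (hy2 : (h + q) * y ≤ g + p) {t : ℤ} (ht1 : -q < t)
    (ht2 : t < q + h) : ⌈(t : ℚ) * y⌉ = ⌈(t : ℚ) * (p / q)⌉ := by
  have hqq : (0 : ℚ) < q := by exact_mod_cast hq
  have hhq : (0 : ℚ) < h := by exact_mod_cast hh
  have hdq : (h * p - g * q : ℚ) = 1 := by exact_mod_cast hdet
  have hyx : y < p / q := by
    rw [lt_div_iff₀ hqq]
    nlinarith
  obtain ⟨a, ha⟩ : ∃ a, a = ⌈(t : ℚ) * (p / q)⌉ := ⟨_, rfl⟩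
  rw [← ha]
  obtain ⟨h1, h2⟩ := Int.ceil_eq_iff.1 ha.symm
  have h1' : (a - 1) * q < t * p := by
    rw [← mul_div_assoc, lt_div_iff₀ hqq] at h1
    exact_mod_cast h1
  have h2' : t * p ≤ a * q := by
    rw [← mul_div_assoc, div_le_iff₀ hqq] at h2
    exact_mod_cast h2
  rw [Int.ceil_eq_iff]
  rcases lt_trichotomy t 0 with ht | rfl | ht
  · have htq : (t : ℚ) < 0 := by exact_mod_cast ht
    refine ⟨by nlinarith, ?_⟩
    by_contra! hc
    have h3 : h * a < t * g := by
      have : (h * a : ℚ) < t * g := by nlinarith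
      exact_mod_cast this
    nlinarith
  · constructor
    · push_cast at h1 ⊢
      simpa using h1
    · simpa using h2
  · have htq : (0 : ℚ) < t := by exact_mod_cast ht
    refine ⟨?_, by nlinarith⟩
    by_contra! hc
    have h3 : t * g < h * (a - 1) := by
      have : (t * g : ℚ) < h * (a - 1) := by nlinarith
      exact_mod_cast this
    nlinarith

/-- The number of integers in `[t * y, (t + 1) * y)`. -/
def step (y : ℚ) (t : ℤ) : ℕ := (⌈((t + 1 : ℤ) : ℚ) * y⌉ - ⌈(t : ℚ) * y⌉).toNat

theorem natCast_step {y : ℚ} (hy : 0 ≤ y) (t : ℤ) :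
    (step y t : ℤ) = ⌈((t + 1 : ℤ) : ℚ) * y⌉ - ⌈(t : ℚ) * y⌉ := by
  have : ⌈(t : ℚ) * y⌉ ≤ ⌈((t + 1 : ℤ) : ℚ) * y⌉ := by
    apply Int.ceil_le_ceil
    push_cast
    nlinarith
  rw [step, Int.toNat_of_nonneg (by omega)]

theorem step_add_period {y : ℚ} {N D : ℤ} (h : (N : ℚ) * y = D) (t : ℤ) :
    step y (t + N) = step y t := by
  have key : ∀ u : ℤ, ⌈((u + N : ℤ) : ℚ) * y⌉ = ⌈(u : ℚ) * y⌉ + D := by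
    intro u
    rw [← Int.ceil_add_intCast]
    push_cast
    rw [add_mul, h]
  rw [step, step, show t + N + 1 = (t + 1) + N by ring, key, key]
  congr 1
  ring

theorem step_add_mul_period {y : ℚ} {N D : ℤ} (h : (N : ℚ) * y = D) (t k : ℤ) :
    step y (t + k * N) = step y t := by
  apply step_add_period (D := k * D)
  push_cast
  rw [mul_assoc, h]

theorem map_floor_range_ceil {α : Type} (f : ℕ → α) {s : ℚ} (hs : 0 < s) (J : ℕ) :
    (List.range ⌈(J : ℚ) * s⁻¹⌉₊).map (fun i : ℕ => f ⌊(i : ℚ) * s⌋.toNat) =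
      ((List.range J).map fun j : ℕ => List.replicate (step s⁻¹ j) (f j)).flatten := by
  have hy : 0 < s⁻¹ := by positivity
  induction J with
  | zero => simp
  | succ J ih =>
    have hst : ⌈((J + 1 : ℕ) : ℚ) * s⁻¹⌉₊ = ⌈(J : ℚ) * s⁻¹⌉₊ + step s⁻¹ J := by
      have := natCast_step hy.le J
      zify
      rw [this, Int.natCast_ceil_eq_ceil (by positivity), Int.natCast_ceil_eq_ceil (by positivity)]
      push_cast
      ring
    rw [hst, List.range_add, List.map_append, ih, List.range_succ, List.map_append,
      List.flatten_append]
    congr 1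
    rw [List.map_map, List.map_singleton, List.flatten_singleton, List.eq_replicate_iff]
    refine ⟨by simp, fun b hb => ?_⟩
    obtain ⟨i, hi, rfl⟩ := List.mem_map.1 hb
    rw [List.mem_range] at hi
    simp only [Function.comp]
    congr 1
    have h1 : (J : ℚ) * s⁻¹ ≤ (⌈(J : ℚ) * s⁻¹⌉₊ + i : ℕ) := by
      push_cast
      linarith [Nat.le_ceil ((J : ℚ) * s⁻¹), (Nat.cast_nonneg i : (0 : ℚ) ≤ i)]
    have h2 : ((⌈(J : ℚ) * s⁻¹⌉₊ + i : ℕ) : ℚ) < (J + 1 : ℕ) * s⁻¹ := by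
      apply Nat.lt_ceil.1
      omega
    rw [mul_inv_le_iff₀ hs] at h1
    rw [lt_mul_inv_iff₀ hs] at h2
    rw [show ⌊((⌈(J : ℚ) * s⁻¹⌉₊ + i : ℕ) : ℚ) * s⌋ = J from
      Int.floor_eq_iff.2 ⟨by exact_mod_cast h1, by exact_mod_cast h2⟩]
    simp

theorem step_pos {y : ℚ} (hy : 1 ≤ y) (t : ℤ) : 0 < step y t := by
  have h := natCast_step (zero_le_one.trans hy) t
  have h1 : ⌈(t : ℚ) * y⌉ + 1 ≤ ⌈((t + 1 : ℤ) : ℚ) * y⌉ := by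
    rw [← Int.ceil_add_one]
    apply Int.ceil_le_ceil
    push_cast
    linarith
  omega

theorem num_mul_inv {s : ℚ} (hs : s ≠ 0) : (s.num : ℚ) * s⁻¹ = (s.den : ℤ) := by
  have := Rat.num_ne_zero.2 hs
  nth_rw 2 [← Rat.num_div_den s]
  push_cast
  field_simp

theorem signList_eq (s : ℚ) :
    signList s = (List.range (2 * s.den)).map fun i : ℕ => (-1 : ℤ) ^ ⌊(i : ℚ) * s⌋.toNat := by
  have h : ∀ l : List ℕ, (do let a ← l; pure (a : ℚ)) = l.map fun i : ℕ => (i : ℚ) :=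
    fun l => List.flatMap_pure_eq_map _ l
  rw [signList, h, List.map_map]
  rfl

theorem CS_eq {s : ℚ} (hs : 0 < s) (hs1 : s ≤ 1) :
    CS s = (List.range (2 * s.num.toNat)).map fun j : ℕ => step s⁻¹ j := by
  have hnum : (s.num.toNat : ℤ) = s.num := Int.toNat_of_nonneg (Rat.num_pos.2 hs).le
  have hnumq : (s.num.toNat : ℚ) = s.num := by exact_mod_cast hnum
  have hceil : ⌈((2 * s.num.toNat : ℕ) : ℚ) * s⁻¹⌉₊ = 2 * s.den := by
    rw [show ((2 * s.num.toNat : ℕ) : ℚ) * s⁻¹ = (2 * s.den : ℕ) by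
      push_cast
      rw [hnumq, mul_assoc, num_mul_inv hs.ne']
      push_cast
      rfl]
    exact Nat.ceil_natCast _
  have hpos : ∀ t, step s⁻¹ t ≠ 0 := fun t => (step_pos ((one_le_inv₀ hs).2 hs1) t).ne'
  have hfl := map_floor_range_ceil (fun k => (-1 : ℤ) ^ k) hs (2 * s.num.toNat)
  rw [hceil] at hfl
  rw [CS, runLengths, signList_eq, hfl, List.splitBy_flatten]
  · rw [List.map_map]
    apply List.map_congr_left
    intro j _
    simp
  · simp [hpos]
  · intro l hl
    obtain ⟨j, _, rfl⟩ := List.mem_map.1 hl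
    exact List.isChain_replicate_of_rel _ (by simp)
  · rw [List.isChain_map]
    have : ∀ n, List.IsChain (fun a b => b = a + 1) (List.range n) := fun n => by
      rw [List.isChain_range]
      simp
    refine (this _).imp ?_
    rintro a _ rfl
    refine ⟨by simp [hpos], by simp [hpos, -Nat.cast_add], ?_⟩
    rw [List.getLast_replicate, List.head_replicate, pow_succ]
    rcases neg_one_pow_eq_or ℤ a with h | h <;> simp [h]

theorem ceil_eq_sum_of_pal {y : ℚ} (hy : 0 ≤ y) {a b n : ℤ}
    (h : ∀ i : ℕ, (i : ℤ) < n → step y (a + i) = step y (b - 1 - i)) (i : ℕ) (hi : (i : ℤ) ≤ n) :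
    ⌈((a + i : ℤ) : ℚ) * y⌉ - ⌈(a : ℚ) * y⌉ = ⌈(b : ℚ) * y⌉ - ⌈((b - i : ℤ) : ℚ) * y⌉ := by
  induction i with
  | zero => simp
  | succ i ih =>
    have h1 := ih (by push_cast at hi; omega)
    have h2 := natCast_step hy (a + i)
    have h3 := natCast_step hy (b - 1 - i)
    rw [h i (by push_cast at hi; omega)] at h2
    generalize (step y (b - 1 - i) : ℤ) = v at h2 h3
    rw [show a + (i : ℤ) + 1 = a + (i + 1 : ℕ) by push_cast; ring] at h2
    rw [show b - 1 - (i : ℤ) + 1 = b - i by ring,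
      show b - 1 - (i : ℤ) = b - (i + 1 : ℕ) by push_cast; ring] at h3
    omega

/-- The palindromic factorization of a Christoffel word is cut at the inverse of `p` mod `q`. -/
theorem eq_of_pal_factors {p q g h h' : ℤ} (hh : 0 < h) (hhq : h ≤ q) (hdet : h * p - g * q = 1)
    (hh' : 0 < h') (hhq' : h' < q)
    (hp : 0 < p)
    (h1 : ∀ i : ℕ, (i : ℤ) < h' → step (p / q) i = step (p / q) (h' - 1 - i))
    (h2 : ∀ i : ℕ, (i : ℤ) < q - h' → step (p / q) (h' + i) = step (p / q) (q - 1 - i)) :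
    h' = h := by
  have hq : 0 < q := by omega
  have hqq : (0 : ℚ) < q := by exact_mod_cast hq
  have hpq : (0 : ℚ) < p := by exact_mod_cast hp
  have hy : (0 : ℚ) ≤ p / q := by positivity
  have hC : ∀ t : ℤ, t * p ≤ ⌈(t : ℚ) * (p / q)⌉ * q ∧ ⌈(t : ℚ) * (p / q)⌉ * q < t * p + q := by
    intro t
    obtain ⟨a, ha⟩ : ∃ a, a = ⌈(t : ℚ) * (p / q)⌉ := ⟨_, rfl⟩
    rw [← ha]
    obtain ⟨h1, h2⟩ := Int.ceil_eq_iff.1 ha.symm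
    rw [← mul_div_assoc, lt_div_iff₀ hqq] at h1
    rw [← mul_div_assoc, div_le_iff₀ hqq] at h2
    have h1' : (a - 1) * q < t * p := by exact_mod_cast h1
    exact ⟨by exact_mod_cast h2, by linarith⟩
  set C : ℤ → ℤ := fun t => ⌈(t : ℚ) * (p / q)⌉ with hCdef
  change ∀ t : ℤ, t * p ≤ C t * q ∧ C t * q < t * p + q at hC
  have e1 : ∀ i : ℕ, (i : ℤ) ≤ h' → C i = C h' - C (h' - i) := by
    intro i hi
    have := ceil_eq_sum_of_pal hy (a := 0) (b := h') (n := h') (by simpa using h1) i hi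
    simpa [hCdef] using this
  have e2 : ∀ i : ℕ, (i : ℤ) ≤ q - h' → C (h' + i) - C h' = C q - C (q - i) :=
    fun i hi => ceil_eq_sum_of_pal hy h2 i hi
  have hCq : C q = p := by
    have : (q : ℚ) * (p / q) = (p : ℤ) := by field_simp
    simp only [hCdef]
    rw [this, Int.ceil_intCast]
  have hCh : C h * q = h * p + (q - 1) := by
    have h3 := hC h
    have h4 : C h = g + 1 := by
      apply le_antisymm
      · by_contra! hc
        nlinarith
      · by_contra! hc
        nlinarith
    rw [h4]
    linarith
  have hmax : C h * q - h * p ≤ C h' * q - h' * p := by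
    rcases le_total h h' with hle | hle
    · obtain ⟨i, rfl⟩ := Int.eq_ofNat_of_zero_le hh.le
      rw [e1 i hle]
      have := (hC (h' - i)).1
      nlinarith
    · obtain ⟨i, hi⟩ := Int.eq_ofNat_of_zero_le (sub_nonneg.2 hle)
      obtain rfl : h = h' + i := by omega
      have h3 := e2 i (by omega)
      rw [hCq] at h3
      have h4 := (hC (q - i)).1
      have h5 : C (h' + i) = C h' + p - C (q - i) := by omega
      rw [h5]
      nlinarith
  have hfin : C h' * q = h' * p + (q - 1) := by
    have := (hC h').2
    linarith
  have hdvd : q ∣ (h' - h) * p := ⟨C h' - C h, by linarith⟩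
  have hcop : IsCoprime q p := ⟨-g, h, by linarith⟩
  obtain ⟨c, hc⟩ := hcop.dvd_of_dvd_mul_right hdvd
  have hc0 : c = 0 := by
    have : -1 < c := by
      by_contra! h
      nlinarith
    have : c < 1 := by
      by_contra! h
      nlinarith
    omega
  rw [hc0] at hc
  omega

/-- The values of `f` at the `n` consecutive integers starting with `a`. -/
def block (f : ℤ → ℕ) (a : ℤ) (n : ℕ) : List ℕ := (List.range n).map fun i : ℕ => f (a + i)

theorem length_block (f : ℤ → ℕ) (a : ℤ) (n : ℕ) : (block f a n).length = n := by
  simp [block]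

theorem block_add (f : ℤ → ℕ) (a : ℤ) (m n : ℕ) :
    block f a (m + n) = block f a m ++ block f (a + m) n := by
  simp [block, List.range_add, Function.comp_def, add_assoc]

theorem block_one (f : ℤ → ℕ) (a : ℤ) : block f a 1 = [f a] := by
  simp [block]

theorem block_congr {f f' : ℤ → ℕ} {a a' : ℤ} {n : ℕ}
    (h : ∀ i : ℕ, i < n → f (a + i) = f' (a' + i)) : block f a n = block f' a' n :=
  List.map_congr_left fun i hi => h i (List.mem_range.1 hi)

theorem eq_of_reverse_block_eq {f : ℤ → ℕ} {a : ℤ} {n : ℕ}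
    (h : (block f a n).reverse = block f a n) {i : ℕ} (hi : i < n) :
    f (a + i) = f (a + n - 1 - i) := by
  have h1 : (block f a n)[i]? = (block f a n).reverse[i]? := by rw [h]
  rw [List.getElem?_reverse (by rwa [length_block]), length_block] at h1
  simp only [block, List.getElem?_map, List.getElem?_range hi,
    List.getElem?_range (show n - 1 - i < n by omega), Option.map_some, Option.some.injEq] at h1
  rw [h1]
  congr 1
  omega

theorem CS_eq_block {s : ℚ} (hs : 0 < s) (hs1 : s ≤ 1) :
    CS s = block (step s⁻¹) 0 (2 * s.num.toNat) := by
  rw [CS_eq hs hs1]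
  simp [block]

/-- Any block of consecutive terms of the bi-infinite run-length sequence which is no longer than
`CS s` occurs in the cyclic sequence `CS s`. -/
theorem cyclicContains_block {s : ℚ} (hs : 0 < s) (hs1 : s ≤ 1) {j n : ℕ}
    (hj : j ≤ 2 * s.num.toNat) (hn : n ≤ 2 * s.num.toNat) :
    CyclicContains (CS s) (block (step s⁻¹) (-j) n) := by
  have hnum : (s.num.toNat : ℤ) = s.num := Int.toNat_of_nonneg (Rat.num_pos.2 hs).le
  obtain ⟨k, hk⟩ := Nat.exists_eq_add_of_le' hj
  obtain ⟨l, hl⟩ := Nat.exists_eq_add_of_le hn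
  refine ⟨k, block (step s⁻¹) (-j + n) l, ?_⟩
  have hper : block (step s⁻¹) (0 + k) j = block (step s⁻¹) (-j) j := by
    refine block_congr fun i _ => ?_
    rw [← step_add_mul_period (num_mul_inv hs.ne') (-(j : ℤ) + i) 2]
    congr 1
    rw [← hnum]
    omega
  have hrot : (block (step s⁻¹) 0 (k + j)).rotate k = block (step s⁻¹) (-j) (j + k) := by
    nth_rw 2 [← length_block (step s⁻¹) 0 k]
    rw [block_add, List.rotate_append_length_eq, hper, block_add, neg_add_cancel]
  rw [CS_eq_block hs hs1, ← block_add, ← hl, hk, hrot, add_comm]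

theorem block_add_two (f : ℤ → ℕ) (a : ℤ) (n : ℕ) :
    block f a (n + 2) = [f a] ++ block f (a + 1) n ++ [f (a + n + 1)] := by
  rw [show n + 2 = 1 + n + 1 by ring, block_add, block_add, block_one, block_one,
    show a + ((1 + n : ℕ) : ℤ) = a + n + 1 by push_cast; ring, Nat.cast_one]

/-- Run lengths for a slope `y` between `g / h` and the mediant `(g + p) / (h + q)`, compared with
the run lengths for the slope `p / q`: only the two outer terms differ. -/
theorem block_step_eq_of_farey {p q g h : ℤ} (hq : 0 < q) (hh : 0 < h) (hhq : h < q)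
    (hdet : h * p - g * q = 1) {y : ℚ} (hy0 : 0 ≤ y) (hp : 0 < p)
    (hy1 : g < h * y) (hy2 : (h + q) * y ≤ g + p) {m n : ℕ} (hn : (n : ℤ) + 2 = 2 * q + h)
    (hfst : step (p / q) 0 = m + 1) (hlst : step (p / q) (n + 1) = m + 1) :
    block (step y) (-q) (n + 2) = [m] ++ block (step (p / q)) 1 n ++ [m] := by
  have hqq : (0 : ℚ) < q := by exact_mod_cast hq
  have hpq : (0 : ℚ) < p := by exact_mod_cast hp
  have hhh : (0 : ℚ) < h := by exact_mod_cast hh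
  have hhqq : (h : ℚ) + 1 ≤ q := by exact_mod_cast hhq
  have hh1 : (1 : ℚ) ≤ h := by exact_mod_cast hh
  have hdq : (h * p - g * q : ℚ) = 1 := by exact_mod_cast hdet
  have hx0 : (0 : ℚ) ≤ p / q := by positivity
  have hper : ∀ t k : ℤ, step (p / q) (t + k * q) = step (p / q) t :=
    step_add_mul_period (D := p) (by field_simp)
  have hceil : ∀ t : ℤ, -q < t → t < q + h → ⌈(t : ℚ) * y⌉ = ⌈(t : ℚ) * (p / q)⌉ :=
    fun t => ceil_mul_eq_of_farey hq hh hdet hy1 hy2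
  have c1 : ⌈((-q : ℤ) : ℚ) * y⌉ = 1 - p := by
    rw [Int.ceil_eq_iff]
    push_cast
    constructor <;> nlinarith
  have c2 : ⌈((-q : ℤ) : ℚ) * (p / q)⌉ = -p := by
    rw [show ((-q : ℤ) : ℚ) * (p / q) = (-p : ℤ) by push_cast; field_simp, Int.ceil_intCast]
  have c3 : ⌈((q + h : ℤ) : ℚ) * y⌉ = p + g := by
    rw [Int.ceil_eq_iff]
    push_cast
    constructor <;> nlinarith
  have c4 : ⌈((q + h : ℤ) : ℚ) * (p / q)⌉ = p + g + 1 := by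
    rw [Int.ceil_eq_iff, ← mul_div_assoc, lt_div_iff₀ hqq, div_le_iff₀ hqq]
    push_cast
    constructor <;> nlinarith
  have e1 : step y (-q) = m := by
    have h1 := natCast_step hy0 (-q)
    have h2 := natCast_step hx0 (-q)
    have h3 := hper (-q) 1
    rw [one_mul, neg_add_cancel] at h3
    rw [hceil (-q + 1) (by omega) (by omega)] at h1
    omega
  have e2 : step y (-q + n + 1) = m := by
    have h3 := hper (-q + n + 1) 1
    rw [show -q + (n : ℤ) + 1 + 1 * q = n + 1 by ring] at h3
    rw [show -q + (n : ℤ) + 1 = q + h - 1 by omega] at h3 ⊢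
    have h1 := natCast_step hy0 (q + h - 1)
    have h2 := natCast_step hx0 (q + h - 1)
    rw [sub_add_cancel] at h1 h2
    rw [hceil (q + h - 1) (by omega) (by omega)] at h1
    omega
  rw [block_add_two, e1, e2, block_congr (f' := step (p / q)) (a' := 1)]
  intro i hi
  have h1 := hper (-q + 1 + i) 1
  rw [show -q + 1 + (i : ℤ) + 1 * q = 1 + i by ring] at h1
  rw [h1, step, step, hceil _ (by omega) (by omega), hceil _ (by omega) (by omega)]

/-- Lemma 2.4(2): if `k` is odd and `[m₁,…,m_k-1,2] ≤ s < [m₁,…,m_k-1]`, then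
`CS(s)` contains `(m, S₁ₑ, S₂, S₁, S₂, S₁_b, m)` as a subsequence, where
`S₁ = (m+1, S₁ₑ) = (S₁_b, m+1)`. -/
theorem statement6
    (M : List ℕ) (m n : ℕ) (r : ℚ)
    (hMlen : 2 ≤ M.length) (hMpos : ∀ x ∈ M, 0 < x) (hMlast : 2 ≤ M.getLast!)
    (hm : M.head? = some m) (hn : 2 ≤ n) (hr : r = cfQ M)
    (S1 S2 : List ℕ) (hdec : CS r = S1 ++ S2 ++ S1 ++ S2)
    (hS1ne : S1 ≠ []) (hS2ne : S2 ≠ [])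
    (hS1pal : S1.reverse = S1) (hS2pal : S2.reverse = S2)
    (hS1h : S1.head? = some (m + 1)) (hS2h : S2.head? = some m)
    (hk : ¬ Even M.length) (s : ℚ)
    (hs1 : cfQ (M.dropLast ++ [M.getLast! - 1, 2]) ≤ s)
    (hs2 : s < cfQ (M.dropLast ++ [M.getLast! - 1])) :
    CyclicContains (CS s)
      ([m] ++ S1.tail ++ S2 ++ S1 ++ S2 ++ S1.dropLast ++ [m]) := by
  have hM0 : M ≠ [] := by
    rintro rfl
    simp at hMlen
  obtain ⟨L, k, rfl⟩ : ∃ L k, M = L ++ [k] :=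
    ⟨M.dropLast, M.getLast hM0, (List.dropLast_append_getLast hM0).symm⟩
  have hlast : (L ++ [k]).getLast! = k := List.getLast!_of_getLast? (by simp)
  rw [hlast] at hMlast hs1 hs2
  rw [List.dropLast_concat] at hs1 hs2
  have hLe : Even L.length := by
    rw [List.length_append, List.length_singleton, Nat.even_add_one, not_not] at hk
    exact hk
  have hL : ∀ x ∈ L, 0 < x := fun x hx => hMpos x (by simp [hx])
  obtain ⟨p, q, g, h, hp, hg, hh, hhq, hdet, hcr, hcA, hcB⟩ := exists_farey_neighbour L hL hLe hMlast
  have hr1 : r ≤ 1 := hr ▸ cfQ_le_one hMpos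
  have hs_le : s ≤ 1 := hs2.le.trans <| cfQ_le_one fun x hx => by
    rcases List.mem_append.1 hx with hx | hx
    · exact hL x hx
    · rw [List.mem_singleton.1 hx]
      omega
  rw [hcr] at hr
  rw [hcA] at hs2
  rw [hcB] at hs1
  have hq : 0 < q := hh.trans_le hhq
  have hqq : (0 : ℚ) < q := by exact_mod_cast hq
  have hpq : (0 : ℚ) < p := by exact_mod_cast hp
  have hgq : (0 : ℚ) < g := by exact_mod_cast hg
  have hhqq : (0 : ℚ) < h := by exact_mod_cast hh
  have hdq : (h * p - g * q : ℚ) = 1 := by exact_mod_cast hdet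
  have hr0 : 0 < r := by rw [hr]; positivity
  have hs0 : 0 < s := lt_of_lt_of_le (by positivity) hs1
  have hrnum : r.num = q := by
    rw [hr]
    exact Rat.num_div_eq_of_coprime hp (Int.isCoprime_iff_nat_coprime.1 ⟨-g, h, by linarith⟩)
  have hrinv : r⁻¹ = p / q := by rw [hr, inv_div]
  have hper : ∀ t : ℤ, step (p / q) (t + q) = step (p / q) t := fun t =>
    step_add_period (D := p) (by field_simp) t
  obtain ⟨Q, rfl⟩ := Int.eq_ofNat_of_zero_le hq.le
  obtain ⟨H, rfl⟩ := Int.eq_ofNat_of_zero_le hh.le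
  -- identify the palindromic factors as blocks of the run-length sequence of `r`
  rw [CS_eq_block hr0 hr1, hrnum, hrinv, Int.toNat_natCast] at hdec
  have hlen : S1.length + S2.length = Q := by
    have := congrArg List.length hdec
    simp only [length_block, List.length_append] at this
    omega
  have hlen1 := List.length_pos_iff.2 hS1ne
  have hlen2 := List.length_pos_iff.2 hS2ne
  have hS12 : S1 ++ S2 = block (step (p / (Q : ℤ))) 0 Q := by
    rw [two_mul, block_add, List.append_assoc (S1 ++ S2)] at hdec
    exact (List.append_inj hdec (by simp [length_block, hlen])).1.symm
  obtain ⟨hS1, hS2⟩ : S1 = block (step (p / (Q : ℤ))) 0 S1.length ∧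
      S2 = block (step (p / (Q : ℤ))) S1.length S2.length := by
    have h1 : S1 ++ S2 = block (step (p / (Q : ℤ))) 0 (S1.length + S2.length) := by rw [hS12, hlen]
    rw [block_add, zero_add] at h1
    exact List.append_inj h1 (by simp [length_block])
  have hH : S1.length = H := by
    have := eq_of_pal_factors (h' := S1.length) hh hhq hdet (by omega) (by omega) hp
      (fun i hi => by
        rw [hS1] at hS1pal
        have := eq_of_reverse_block_eq hS1pal (Int.ofNat_lt.1 hi)
        simpa using this)
      (fun i hi => by
        rw [hS2] at hS2pal
        have := eq_of_reverse_block_eq hS2pal (show i < S2.length by omega)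
        rw [this]
        congr 1
        omega)
    exact_mod_cast this
  have hHQ : H < Q := by omega
  -- the longer word `S1 S2 S1 S2 S1` is again a block
  obtain ⟨n', hn'⟩ : ∃ n', n' + 2 = 2 * Q + H := ⟨2 * Q + H - 2, by omega⟩
  have hW : S1 ++ S2 ++ S1 ++ S2 ++ S1 = block (step (p / (Q : ℤ))) 0 (n' + 2) := by
    rw [hn', block_add, hdec, ← hH]
    nth_rw 3 [hS1]
    congr 1
    refine block_congr fun i _ => ?_
    rw [← hper (0 + i), ← hper (0 + i + Q)]
    congr 1
    push_cast
    ring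
  have hhead : S1 = [m + 1] ++ S1.tail := (List.cons_head?_tail hS1h).symm
  have hlst : S1 = S1.dropLast ++ [m + 1] := by
    have h1 : S1.getLast? = some (m + 1) := by rw [← hS1h, ← List.head?_reverse, hS1pal]
    exact (List.dropLast_append_getLast? _ h1).symm
  have hX : [m + 1] ++ (S1.tail ++ S2 ++ S1 ++ S2 ++ S1.dropLast) ++ [m + 1] =
      S1 ++ S2 ++ S1 ++ S2 ++ S1 := by
    nth_rw 4 [hhead]
    nth_rw 6 [hlst]
    simp only [List.append_assoc]
  rw [hW, block_add_two] at hX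
  obtain ⟨hX1, hX2⟩ := List.append_inj' hX rfl
  obtain ⟨hX3, hX4⟩ := List.append_inj hX1 rfl
  have hy1 : (g : ℚ) < (H : ℤ) * s⁻¹ := by
    rw [lt_mul_inv_iff₀ hs0]
    rw [lt_div_iff₀ hgq] at hs2
    linarith
  have hy2 : ((H : ℤ) + (Q : ℤ) : ℚ) * s⁻¹ ≤ g + p := by
    rw [mul_inv_le_iff₀ hs0]
    rw [div_le_iff₀ (by positivity)] at hs1
    linarith
  have hT := block_step_eq_of_farey hq hh (Int.ofNat_lt.2 hHQ) hdet (inv_nonneg.2 hs0.le) hp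
    hy1 hy2 (m := m) (n := n') (by exact_mod_cast hn') (by simpa using hX3.symm)
    (by simpa using hX2.symm)
  rw [zero_add] at hX4
  rw [← hX4] at hT
  have hsnum : H + Q ≤ s.num.toNat := by
    have hnum : (s.num.toNat : ℤ) = s.num := Int.toNat_of_nonneg (Rat.num_pos.2 hs0).le
    have hd : (0 : ℚ) < s.den := by exact_mod_cast s.pos
    have hsd : s = s.num / s.den := (Rat.num_div_den s).symm
    have h1 : s.num * g < H * s.den := by
      rw [hsd, div_lt_div_iff₀ hd hgq] at hs2
      exact_mod_cast hs2
    have h2 : (H + Q) * (s.den : ℤ) ≤ s.num * (g + p) := by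
      rw [hsd, div_le_div_iff₀ (by positivity) hd] at hs1
      exact_mod_cast hs1
    zify
    rw [hnum]
    nlinarith
  have hfin := cyclicContains_block hs0 hs_le (j := Q) (n := n' + 2) (by omega) (by omega)
  rw [hT] at hfin
  simpa only [List.append_assoc] using hfin

end Heckoid
end

section
/- Suppose k is even and s is a rational number with [m_1, …, m_k, 2n−2] < s < [m_1, …, m_{k−1}]. Then there exists an integer d with 1 ≤ d ≤ 2n−3 such that CS(s) contains (m, S_{1e}, d⟨S_2, S_1⟩, S_2, S_{1b}, m) as a subsequence. -/
/- Formalization of statements from "Homotopically equivalent simple loops on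
2-bridge spheres in Heckoid orbifolds for 2-bridge links (II)" by Lee-Sakuma.

We work in the free group `F` on two generators `a = gen 0`, `b = gen 1`.
For a rational `s` (in lowest terms `q/p`, with `0 ≤ s ≤ 1`), `uWord s` is the
word `u_s = a b^{ε₁} a^{ε₂} ⋯ b^{ε_{2p-1}}` with `ε_i = (-1)^⌊i·s⌋`.
`CS s` is (a linear representative of) the cyclic sequence of lengths of
maximal constant-sign runs of exponents of `u_s`; since `u_s` begins with a
positive letter and (for `0 < s ≤ 1`) ends with a negative letter, the linear
run-length sequence represents the cyclic one.  `CyclicContains L T` says the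
cyclic sequence represented by `L` contains `T` as a block of consecutive
terms.  `cfQ [m₁,…,m_k]` is the continued fraction `1/(m₁+1/(m₂+⋯+1/m_k))`.
`memI1 M n s` / `memI2 M n s` express `s ∈ I₁(r;n)` / `s ∈ I₂(r;n)` where
`r = cfQ M`, and `memI1hat` / `memI2hat` express `s ∈ I₁(r)` / `s ∈ I₂(r)`.
The Heckoid group `Heck(r;n) = ⟨a,b | u_r^n⟩` is the quotient of `F` by the
normal closure `heckN r n` of `u_r^n`, with quotient map `heckQ r n`. -/

namespace Heckoid

/-- The natural number `⌈j * p / q⌉`. -/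
def ceilMul (p q j : ℕ) : ℕ := (j * p + (q - 1)) / q

theorem le_ceilMul (p : ℕ) {q : ℕ} (hq : 0 < q) (j : ℕ) : j * p ≤ q * ceilMul p q j := by
  unfold ceilMul
  have h1 := Nat.div_add_mod (j * p + (q - 1)) q
  have h2 := Nat.mod_lt (j * p + (q - 1)) hq
  lia

theorem ceilMul_lt (p : ℕ) {q : ℕ} (hq : 0 < q) (j : ℕ) :
    q * ceilMul p q j < j * p + q := by
  unfold ceilMul
  have h1 := Nat.div_add_mod (j * p + (q - 1)) q
  lia

theorem ceilMul_eq {p q j c : ℕ} (hq : 0 < q) (h1 : j * p ≤ q * c) (h2 : q * c < j * p + q) :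
    ceilMul p q j = c := by
  have h3 := le_ceilMul p hq j
  have h4 := ceilMul_lt p hq j
  have h5 : q * c < q * (ceilMul p q j + 1) := by lia
  have h6 : q * ceilMul p q j < q * (c + 1) := by lia
  have := Nat.lt_of_mul_lt_mul_left h5
  have := Nat.lt_of_mul_lt_mul_left h6
  omega

theorem ceilMul_zero (p : ℕ) {q : ℕ} (hq : 0 < q) : ceilMul p q 0 = 0 :=
  ceilMul_eq hq (by simp) (by simpa using hq)

theorem ceilMul_add_mul (p : ℕ) {q : ℕ} (hq : 0 < q) (j a : ℕ) :
    ceilMul p q (j + a * q) = ceilMul p q j + a * p := by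
  have h3 := le_ceilMul p hq j
  have h4 := ceilMul_lt p hq j
  apply ceilMul_eq hq <;> nlinarith

theorem ceilMul_mono (p : ℕ) {q : ℕ} : Monotone (ceilMul p q) := by
  intro i j h
  unfold ceilMul
  gcongr

theorem ceilMul_lt_succ {p q : ℕ} (hq : 0 < q) (hpq : q ≤ p) (j : ℕ) :
    ceilMul p q j < ceilMul p q (j + 1) := by
  have h3 := le_ceilMul p hq (j + 1)
  have h4 := ceilMul_lt p hq j
  have : q * ceilMul p q j < q * ceilMul p q (j + 1) := by lia
  exact Nat.lt_of_mul_lt_mul_left this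

/-- The number of integers `i` with `⌊i * q / p⌋ = j`. -/
def runLen (p q j : ℕ) : ℕ := ceilMul p q (j + 1) - ceilMul p q j

theorem runLen_periodic (p : ℕ) {q : ℕ} (hq : 0 < q) : (runLen p q).Periodic q := by
  intro j
  have h1 := ceilMul_add_mul p hq j 1
  have h2 := ceilMul_add_mul p hq (j + 1) 1
  rw [one_mul] at h1 h2
  unfold runLen
  rw [h1, add_right_comm j q 1, h2]
  omega

theorem map_range_eq_flatten {α : Type*} {f : ℕ → ℕ} (hf : Monotone f) (hf0 : f 0 = 0)
    {v g : ℕ → α} (h : ∀ j i, f j ≤ i → i < f (j + 1) → v i = g j) (n : ℕ) :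
    (List.range (f n)).map v =
      ((List.range n).map fun j => List.replicate (f (j + 1) - f j) (g j)).flatten := by
  induction n with
  | zero => simp [hf0]
  | succ n ih =>
    have hle : f n ≤ f (n + 1) := hf (Nat.le_succ n)
    obtain ⟨c, hc⟩ := Nat.exists_eq_add_of_le hle
    rw [hc, List.range_add, List.map_append, ih, List.range_succ, List.map_append,
      List.flatten_append]
    congr 1
    rw [List.map_singleton, List.flatten_singleton, List.map_map, hc, Nat.add_sub_cancel_left]
    rw [List.eq_replicate_iff]
    refine ⟨by simp, ?_⟩
    intro b hb
    simp only [List.mem_map, List.mem_range, Function.comp_apply] at hb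
    obtain ⟨a, ha, rfl⟩ := hb
    exact h n _ (by omega) (by omega)

theorem runLengths_flatten_replicate {α : Type} [BEq α] [LawfulBEq α] {w : ℕ → ℕ} {g : ℕ → α}
    (hw : ∀ j, 0 < w j) (hg : ∀ j, g j ≠ g (j + 1)) (n : ℕ) :
    runLengths ((List.range n).map fun j => List.replicate (w j) (g j)).flatten =
      (List.range n).map w := by
  unfold runLengths
  rw [List.splitBy_flatten]
  · rw [List.map_map]
    apply List.map_congr_left
    intro a _
    simp
  · intro hmem
    simp only [List.mem_map, List.replicate_eq_nil_iff] at hmem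
    obtain ⟨a, _, ha⟩ := hmem
    exact (hw a).ne' ha
  · intro l hl
    simp only [List.mem_map] at hl
    obtain ⟨a, _, rfl⟩ := hl
    rw [List.isChain_iff_getElem]
    intro i hi
    simp
  · rw [List.isChain_map, List.isChain_range]
    intro j _
    refine ⟨by simp [(hw j).ne'], by simp [(hw _).ne'], ?_⟩
    simpa using hg j

theorem CS_eq_map_runLen {s : ℚ} {q : ℕ} (hq : 0 < q) (hnum : s.num = q) (hpq : q ≤ s.den) :
    CS s = (List.range (2 * q)).map (runLen s.den q) := by
  have hs : s = (q : ℚ) / s.den := by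
    conv_lhs => rw [← Rat.num_div_den s, hnum]
    simp
  have hp : (0 : ℚ) < s.den := by exact_mod_cast s.den_pos
  have h2 : ceilMul s.den q (2 * q) = 2 * s.den := by
    have := ceilMul_add_mul s.den hq 0 2
    simpa [ceilMul_zero _ hq] using this
  have hsign : signList s =
      (List.range (2 * s.den)).map fun i : ℕ => (-1 : ℤ) ^ (⌊(i : ℚ) * s⌋.toNat) := by
    simp [signList, List.map_eq_flatMap, List.flatMap_assoc]
  unfold CS
  rw [hsign, ← h2, map_range_eq_flatten (ceilMul_mono s.den) (ceilMul_zero _ hq)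
    (g := fun j => (-1 : ℤ) ^ j)]
  · exact runLengths_flatten_replicate (w := runLen s.den q)
      (fun j => Nat.sub_pos_of_lt (ceilMul_lt_succ hq hpq j))
      (fun j h => by rw [pow_succ] at h; have := pow_ne_zero j (show (-1 : ℤ) ≠ 0 by simp); lia) _
  · intro j i h3 h4
    have : ⌊(i : ℚ) * s⌋ = j := by
      rw [Int.floor_eq_iff, hs, ← mul_div_assoc, le_div_iff₀ hp, div_lt_iff₀ hp]
      have h5 := le_ceilMul s.den hq j
      have h6 := ceilMul_lt s.den hq (j + 1)
      have h7 : j * s.den ≤ i * q := by nlinarith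
      have h8 : i * q < (j + 1) * s.den := by nlinarith
      exact_mod_cast And.intro h7 h8
    rw [this]
    simp

theorem map_range_rotate {α : Type*} {f : ℕ → α} {q : ℕ} (hf : f.Periodic q) (a k : ℕ) :
    ((List.range (a * q)).map f).rotate k = (List.range (a * q)).map fun j => f (k + j) := by
  have hf' : f.Periodic (a * q) := by simpa using hf.nsmul a
  apply List.ext_getElem
  · simp
  · intro i h1 h2
    rw [List.getElem_rotate]
    simp only [List.getElem_map, List.getElem_range, List.length_map, List.length_range]
    rw [hf'.map_mod_nat, add_comm]

theorem map_range_prefix {α : Type*} (f : ℕ → α) {a b : ℕ} (h : a ≤ b) :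
    (List.range a).map f <+: (List.range b).map f := by
  obtain ⟨c, rfl⟩ := Nat.exists_eq_add_of_le h
  rw [List.range_add, List.map_append]
  exact List.prefix_append _ _

theorem map_range_add_of_periodic {α : Type*} {f : ℕ → α} {q : ℕ} (hf : f.Periodic q) (n : ℕ) :
    (List.range (q + n)).map f = (List.range q).map f ++ (List.range n).map f := by
  rw [List.range_add, List.map_append, List.map_map]
  congr 1
  apply List.map_congr_left
  intro a _
  simp only [Function.comp_apply]
  rw [add_comm, hf]

theorem sum_map_range_runLen (p : ℕ) {q : ℕ} (hq : 0 < q) (n : ℕ) :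
    ((List.range n).map (runLen p q)).sum = ceilMul p q n := by
  induction n with
  | zero => simp [ceilMul_zero _ hq]
  | succ n ih =>
    rw [List.range_succ, List.map_append, List.sum_append, ih]
    have := ceilMul_mono p (q := q) (Nat.le_add_right n 1)
    simp only [runLen, List.map_singleton, List.sum_singleton]
    omega

theorem sum_take_add_sum_take_of_reverse_eq {l : List ℕ} (hl : l.reverse = l) (i : ℕ) :
    (l.take i).sum + (l.take (l.length - i)).sum = l.sum := by
  have h : l.drop i = (l.take (l.length - i)).reverse := by
    conv_lhs => rw [← hl]
    rw [List.drop_reverse]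
  rw [← List.sum_take_add_sum_drop l i, h, List.sum_reverse]

theorem length_eq_of_palindromes {p q t t' : ℕ} (hdet : t * p = q * t' + 1) (htq : t < q)
    {S1 S2 : List ℕ} (hS1 : S1 ≠ []) (hS2 : S2 ≠ [])
    (h : S1 ++ S2 = (List.range q).map (runLen p q))
    (hS1pal : S1.reverse = S1) (hS2pal : S2.reverse = S2) : S1.length = t := by
  have hq : 0 < q := by omega
  have hl1 : 0 < S1.length := List.length_pos_iff.2 hS1
  have hl2 : 0 < S2.length := List.length_pos_iff.2 hS2
  have hlen : S1.length + S2.length = q := by simpa using congrArg List.length h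
  have hsum : ∀ i ≤ q, ((S1 ++ S2).take i).sum = ceilMul p q i := by
    intro i hi
    rw [h, ← List.map_take, List.take_range, min_eq_left hi, sum_map_range_runLen _ hq]
  have hsum1 : ∀ i ≤ S1.length, (S1.take i).sum = ceilMul p q i := by
    intro i hi
    rw [← hsum i (by omega), List.take_append_of_le_length hi]
  have hS1sum : S1.sum = ceilMul p q S1.length := by
    simpa using hsum1 S1.length le_rfl
  have hsum2 : ∀ i ≤ S2.length, S1.sum + (S2.take i).sum = ceilMul p q (S1.length + i) := by
    intro i hi
    rw [← hsum (S1.length + i) (by omega), List.take_length_add_append, List.sum_append]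
  have ht : ceilMul p q t = t' + 1 := ceilMul_eq hq (by lia) (by lia)
  have hp : ceilMul p q q = p := by
    simpa [ceilMul_zero _ hq] using ceilMul_add_mul p hq 0 1
  have key : q * ceilMul p q S1.length + 1 ≥ S1.length * p + q := by
    rcases le_total t S1.length with hle | hle
    · have h1 := sum_take_add_sum_take_of_reverse_eq hS1pal t
      rw [hsum1 _ hle, hsum1 _ (Nat.sub_le _ _), hS1sum, ht] at h1
      have h2 := le_ceilMul p hq (S1.length - t)
      obtain ⟨c, hc⟩ := Nat.exists_eq_add_of_le hle
      rw [← h1]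
      rw [hc, Nat.add_sub_cancel_left] at h2 ⊢
      nlinarith
    · obtain ⟨c, hc⟩ := Nat.exists_eq_add_of_le hle
      obtain ⟨e, he⟩ := Nat.exists_eq_add_of_lt htq
      have h1 := sum_take_add_sum_take_of_reverse_eq hS2pal c
      have h3 := hsum2 c (by omega)
      have h4 := hsum2 (S2.length - c) (by omega)
      have h5 := hsum2 S2.length le_rfl
      rw [List.take_length] at h5
      rw [hlen, hp] at h5
      rw [← hc, ht] at h3
      have h2 := le_ceilMul p hq (S1.length + (S2.length - c))
      have h6 : S1.length + (S2.length - c) + c = q := by omega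
      generalize S1.length + (S2.length - c) = z at *
      have h7 : ceilMul p q z + (t' + 1) = p + ceilMul p q S1.length := by omega
      have h8 := congrArg (q * ·) h7
      simp only [mul_add] at h8
      have h9 : z + t = q + S1.length := by omega
      have h10 := congrArg (· * p) h9
      simp only [add_mul] at h10
      nlinarith
  have h1 := ceilMul_lt p hq S1.length
  have h2 : (q : ℤ) * (ceilMul p q S1.length - 1 - t') = p * (S1.length - t) := by
    zify at *
    linarith
  have hcop : IsCoprime (q : ℤ) p := ⟨-t', t, by zify at hdet; linarith⟩
  have h3 : (q : ℤ) ∣ S1.length - t := hcop.dvd_of_dvd_mul_left ⟨_, h2.symm⟩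
  have h4 := Int.eq_zero_of_abs_lt_dvd h3 (by rw [abs_lt]; constructor <;> omega)
  omega

theorem ceilMul_shift {P Q e e' γ i : ℕ} {w : ℤ} (hQ : 0 < Q) (he : e' * Q = e * P + γ)
    (h1 : (γ : ℤ) ≤ Q * w - i * P) (h2 : Q * w - i * P < (γ : ℤ) + Q) :
    (ceilMul P Q (e * (Q - 1) + i) : ℤ) = e * P + w - e' := by
  have h3 := le_ceilMul P hQ (e * (Q - 1) + i)
  have h4 := ceilMul_lt P hQ (e * (Q - 1) + i)
  generalize ceilMul P Q (e * (Q - 1) + i) = c at *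
  obtain ⟨Q', rfl⟩ : ∃ Q', Q = Q' + 1 := ⟨Q - 1, by omega⟩
  rw [Nat.add_sub_cancel] at h3 h4
  zify at *
  have h5 : ((Q' : ℤ) + 1) * (e * P + w - e') < (Q' + 1) * (c + 1) := by nlinarith
  have h6 : ((Q' : ℤ) + 1) * c < (Q' + 1) * (e * P + w - e' + 1) := by nlinarith
  have h7 := lt_of_mul_lt_mul_left h5 hQ.le
  have h8 := lt_of_mul_lt_mul_left h6 hQ.le
  linarith

/-- Inside the window the partial sums of the run lengths for the nearby slope follow those of
the reference slope. -/
theorem ceilMul_window {p q t t' α β d γ e e' i : ℕ} (hdet : t * p = q * t' + 1)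
    (htq : t < q) (hγ : 0 < γ) (hγβ : γ ≤ β) (hγd : d * β < γ + α)
    (he : e' * (α * q + β * t) = e * (α * p + β * t') + γ)
    (hi0 : 0 < i) (hi : i < (d + 1) * q + t) :
    (ceilMul (α * p + β * t') (α * q + β * t) (e * (α * q + β * t - 1) + i) : ℤ) =
      e * (α * p + β * t' : ℕ) + ceilMul p q i - e' := by
  have hq : 0 < q := by omega
  have ht : 0 < t := Nat.pos_of_ne_zero (by rintro rfl; simp at hdet)
  have hQ : 0 < α * q + β * t := by have := Nat.mul_pos (hγ.trans_le hγβ) ht; omega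
  have h1 := le_ceilMul p hq i
  have h2 := ceilMul_lt p hq i
  generalize ceilMul p q i = v at *
  -- coordinates of `(i, v)` in the unimodular basis given by the two fractions
  obtain ⟨ρ, hρ⟩ : ∃ ρ : ℤ, ρ = q * v - i * p := ⟨_, rfl⟩
  obtain ⟨σ, hσ⟩ : ∃ σ : ℤ, σ = t * v - t' * i := ⟨_, rfl⟩
  have hexp : (α * q + β * t : ℤ) * v - i * (α * p + β * t') = α * ρ + β * σ := by
    rw [hρ, hσ]; ring
  apply ceilMul_shift hQ he
  all_goals
    push_cast
    rw [hexp]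
    zify at *
    have hρ0 : 0 ≤ ρ := by linarith
    have hρq : ρ < q := by linarith
    have hi' : (i : ℤ) = q * σ - t * ρ := by
      rw [hρ, hσ]; linear_combination (-i : ℤ) * hdet
  · have hσ1 : 1 ≤ σ := by
      have h3 : 0 < (q : ℤ) * σ := by nlinarith
      exact pos_of_mul_pos_right h3 hq.le
    have : 0 ≤ (α : ℤ) * ρ := by positivity
    nlinarith
  · have hσd : σ - t ≤ d := by
      by_contra hcon
      have : (d : ℤ) + 1 ≤ σ - t := by omega
      have : (q : ℤ) * (d + 1) ≤ q * (σ - t) := by gcongr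
      have : (t : ℤ) * 1 ≤ t * (q - ρ) := by gcongr; omega
      nlinarith
    have : (β : ℤ) * (σ - t) ≤ β * d := by gcongr
    have : (α : ℤ) * 1 ≤ α * (q - ρ) := by gcongr; omega
    nlinarith

theorem map_runLen_window {p q t t' α β d γ e e' m : ℕ} (hdet : t * p = q * t' + 1)
    (htq : t < q) (hγ : 0 < γ) (hγβ : γ ≤ β) (hγd : d * β < γ + α)
    (hγd' : γ + α ≤ (d + 1) * β)
    (he : e' * (α * q + β * t) = e * (α * p + β * t') + γ) {Y : List ℕ}
    (hY : (List.range ((d + 1) * q + t)).map (runLen p q) = [m + 1] ++ Y ++ [m + 1]) :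
    (List.range ((d + 1) * q + t)).map (fun j => runLen (α * p + β * t') (α * q + β * t)
      (e * (α * q + β * t - 1) + j)) = [m] ++ Y ++ [m] := by
  have hq : 0 < q := by omega
  have ht : 0 < t := Nat.pos_of_ne_zero (by rintro rfl; simp at hdet)
  have hβt : β ≤ β * t := Nat.le_mul_of_pos_right _ ht
  have hQ : 0 < α * q + β * t := by omega
  have hwin := fun i => ceilMul_window (i := i) hdet htq hγ hγβ hγd he
  have h0 := ceilMul_shift (i := 0) (w := 1) hQ he
    (by push_cast; nlinarith) (by push_cast; nlinarith)
  have hL := ceilMul_shift (i := (d + 1) * q + t) (w := (d + 1) * p + t') hQ he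
    (by zify at *; linear_combination hγd' + α * hdet - β * (d + 1) * hdet)
    (by zify at *; nlinarith [mul_nonneg (Int.natCast_nonneg α) (Int.natCast_nonneg q)])
  have hLr : ceilMul p q ((d + 1) * q + t) = (d + 1) * p + t' + 1 := by
    rw [add_comm, ceilMul_add_mul p hq, ceilMul_eq (c := t' + 1) hq (by lia) (by lia)]
    ring
  have h0r := ceilMul_zero p hq
  obtain ⟨L, hLL⟩ : ∃ L, (d + 1) * q + t = L + 1 + 1 :=
    ⟨(d + 1) * q + t - 2, by have := Nat.mul_pos (Nat.succ_pos d) hq; lia⟩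
  rw [hLL] at hwin hL hLr hY ⊢
  have hsplit : ∀ f : ℕ → ℕ, (List.range (L + 1 + 1)).map f =
      [f 0] ++ (List.range L).map (fun j => f (j + 1)) ++ [f (L + 1)] := by
    intro f
    rw [List.range_succ, List.range_succ_eq_map]
    simp [Function.comp_def]
  rw [hsplit] at hY ⊢
  obtain ⟨hY1, hY2⟩ := List.append_inj' hY rfl
  obtain ⟨hY3, hY4⟩ := List.append_inj hY1 rfl
  rw [← hY4]
  simp only [List.cons.injEq, and_true] at hY2 hY3
  have hw1 := hwin 1 (by omega) (by omega)
  have hwL := hwin (L + 1) (by omega) (by omega)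
  unfold runLen at *
  congr 2
  · congr 1
    simp only [add_zero, zero_add] at *
    omega
  · apply List.map_congr_left
    intro j hj
    rw [List.mem_range] at hj
    have := hwin (j + 1) (by omega) (by omega)
    have := hwin (j + 1 + 1) (by omega) (by omega)
    simp only [← add_assoc] at *
    omega
  · simp only [← add_assoc] at *
    zify at hLr
    push_cast at hL hwL
    omega

theorem append_rep2_eq_map_range {S1 S2 : List ℕ} {f : ℕ → ℕ} {q : ℕ} (hf : f.Periodic q)
    (h : S1 ++ S2 = (List.range q).map f) (d : ℕ) :
    S1 ++ rep2 d S2 S1 ++ S2 ++ S1 = (List.range ((d + 1) * q + S1.length)).map f := by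
  have hlen : S1.length ≤ q := by
    have := congrArg List.length h
    simp only [List.length_append, List.length_map, List.length_range] at this
    omega
  have hS1 : (List.range S1.length).map f = S1 := by
    have := congrArg (List.take S1.length) h
    rw [List.take_left, ← List.map_take, List.take_range, min_eq_left hlen] at this
    exact this.symm
  induction d with
  | zero =>
    rw [zero_add, one_mul, map_range_add_of_periodic hf, hS1, ← h]
    simp [rep2]
  | succ d ih =>
    rw [show (d + 1 + 1) * q + S1.length = q + ((d + 1) * q + S1.length) by ring,
      map_range_add_of_periodic hf, ← ih, ← h]
    simp [rep2, List.replicate_succ]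

theorem exists_cfQ_convergents (M : List ℕ) (hne : M ≠ []) (hpos : ∀ x ∈ M, 0 < x)
    (hlast : 2 ≤ M.getLast hne) :
    ∃ q p t t' : ℕ, 0 < q ∧ q ≤ p ∧ 0 < t' ∧ t < q ∧ t' < p ∧
      cfQ M = q / p ∧ cfQ M.dropLast = t / t' ∧
      (∀ N : ℕ, 0 < N → cfQ (M ++ [N]) = (N * q + t) / (N * p + t')) ∧
      (t * p - q * t' : ℤ) = (-1) ^ M.length := by
  induction M with
  | nil => exact absurd rfl hne
  | cons a l ih =>
    have ha : 0 < a := hpos a (by simp)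
    rcases eq_or_ne l [] with rfl | hl
    · simp only [List.getLast_singleton] at hlast
      refine ⟨1, a, 0, 1, by omega, by omega, by omega, by omega, by omega, by simp [cfQ],
        by simp [cfQ], ?_, by simp⟩
      intro N hN
      have : (N : ℚ) ≠ 0 := by positivity
      simp only [cfQ, List.cons_append, List.nil_append]
      push_cast
      field_simp
      ring
    · obtain ⟨q, p, t, t', hq, hqp, ht', htq, htp, hM, hD, hN, hdet⟩ :=
        ih hl (fun x hx => hpos x (by simp [hx])) (by rwa [List.getLast_cons hl] at hlast)
      have hp : 0 < p := by omega
      refine ⟨p, a * p + q, t', a * t' + t, hp, by nlinarith, by positivity, htp, by nlinarith,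
        ?_, ?_, ?_, ?_⟩
      · have : (0 : ℚ) < p := by positivity
        rw [cfQ, hM]
        push_cast
        field_simp
      · have : (0 : ℚ) < t' := by positivity
        rw [List.dropLast_cons_of_ne_nil hl, cfQ, hD]
        push_cast
        field_simp
      · intro N hN0
        have : (0 : ℚ) < N * p + t' := by positivity
        rw [List.cons_append, cfQ, hN N hN0]
        push_cast
        field_simp
        ring
      · rw [List.length_cons, pow_succ, ← hdet]
        push_cast
        ring

theorem exists_window_params {p q t t' α β N : ℕ} (hdet : t * p = q * t' + 1)
    (hα : 0 < α) (hβ : 0 < β) (hN : 2 ≤ N) (hαN : α < N * β) :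
    ∃ d γ e e' : ℕ, 1 ≤ d ∧ d + 1 ≤ N ∧ d ≤ α ∧ 0 < γ ∧ γ ≤ β ∧ d * β < γ + α ∧
      γ + α ≤ (d + 1) * β ∧ e' * (α * q + β * t) = e * (α * p + β * t') + γ := by
  obtain ⟨N, rfl⟩ : ∃ N', N = N' + 1 := ⟨N - 1, by omega⟩
  rcases le_or_gt α (N * β) with h | h
  · have h1 := le_ceilMul α hβ 1
    have h2 := ceilMul_lt α hβ 1
    have h0 : 0 < ceilMul α β 1 := Nat.pos_of_ne_zero (by intro h0; rw [h0] at h1; omega)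
    generalize ceilMul α β 1 = d at *
    refine ⟨d, β, q, p, h0, ?_, ?_, hβ, le_rfl, by lia, by lia, ?_⟩
    · have : β * d < β * (N + 1) := by lia
      have := Nat.lt_of_mul_lt_mul_left this
      omega
    · obtain ⟨d, rfl⟩ : ∃ d', d = d' + 1 := ⟨d - 1, by omega⟩
      nlinarith
    · zify at *
      linear_combination (β : ℤ) * hdet
  · obtain ⟨γ, hγ⟩ := Nat.exists_eq_add_of_lt hαN
    refine ⟨N, γ + 1, (N + 1) * q + t, (N + 1) * p + t', by omega, le_rfl, by nlinarith,
      by omega, by lia, by lia, by lia, ?_⟩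
    zify at *
    linear_combination ((N + 1) * β - α : ℤ) * hdet + hγ

theorem exists_cyclicContains_of_between {p q t t' N m : ℕ} {s : ℚ} (hq : 0 < q) (hqp : q ≤ p)
    (ht' : 0 < t') (htt' : t ≤ t') (htq : t < q) (hdet : t * p = q * t' + 1) (hN : 2 ≤ N)
    (hs1 : ((N * q + t) / (N * p + t') : ℚ) < s) (hs2 : s < t / t') {S1 S2 : List ℕ}
    (hS : S1 ++ S2 = (List.range q).map (runLen p q))
    (hS1 : S1 ≠ []) (hS2 : S2 ≠ []) (hS1pal : S1.reverse = S1) (hS2pal : S2.reverse = S2)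
    (hS1h : S1.head? = some (m + 1)) :
    ∃ d : ℕ, 1 ≤ d ∧ d + 1 ≤ N ∧ CyclicContains (CS s)
      ([m] ++ S1.tail ++ rep2 d S2 S1 ++ S2 ++ S1.dropLast ++ [m]) := by
  have hS1len := length_eq_of_palindromes hdet htq hS1 hS2 hS hS1pal hS2pal
  have hp : 0 < p := hq.trans_le hqp
  have hs0 : 0 < s := lt_of_le_of_lt (by positivity) hs1
  have hnum : 0 < s.num := Rat.num_pos.2 hs0
  obtain ⟨Q, hQ⟩ := Int.eq_ofNat_of_zero_le hnum.le
  have hQ0 : 0 < Q := by omega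
  obtain ⟨P, hP⟩ : ∃ P, P = s.den := ⟨_, rfl⟩
  have hP0 : 0 < P := hP ▸ s.den_pos
  have hsQP : s = (Q : ℚ) / P := by
    conv_lhs => rw [← Rat.num_div_den s, hQ, ← hP]
    simp
  rw [hsQP, div_lt_div_iff₀ (by positivity) (by positivity)] at hs1 hs2
  have hs1' : (N * q + t) * P < Q * (N * p + t') := by exact_mod_cast hs1
  have hs2' : Q * t' < t * P := by exact_mod_cast hs2
  obtain ⟨α, hα⟩ := Nat.exists_eq_add_of_lt hs2'
  have hqP : q * P < p * Q := by
    by_contra! hcon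
    nlinarith
  obtain ⟨β, hβ⟩ := Nat.exists_eq_add_of_lt hqP
  have hPe : P = (α + 1) * p + (β + 1) * t' := by
    zify at *
    linear_combination (-P : ℤ) * hdet + p * hα + t' * hβ
  have hQe : Q = (α + 1) * q + (β + 1) * t := by
    zify at *
    linear_combination (-Q : ℤ) * hdet + q * hα + t * hβ
  have hαN : α + 1 < N * (β + 1) := by
    zify at *
    linear_combination hs1' - hα + N * hβ
  have hQP : Q ≤ P := by
    rw [hQe, hPe]
    gcongr
  obtain ⟨d, γ, e, e', hd1, hdN, hdα, hγ, hγβ, hγd, hγd', he⟩ :=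
    exists_window_params hdet (Nat.succ_pos α) (Nat.succ_pos β) hN hαN (q := q)
  refine ⟨d, hd1, hdN, e * (Q - 1), ?_⟩
  have hX := append_rep2_eq_map_range (runLen_periodic p hq) hS d
  rw [hS1len] at hX
  obtain ⟨T, rfl⟩ : ∃ T, S1 = (m + 1) :: T := by
    cases S1 with
    | nil => exact absurd rfl hS1
    | cons x T => exact ⟨T, by simpa using hS1h⟩
  have hlast : (m + 1) :: T = ((m + 1) :: T).dropLast ++ [m + 1] := by
    have h1 := List.dropLast_append_getLast (l := (m + 1) :: T) (by simp)
    have h2 : ((m + 1) :: T).getLast (by simp) = m + 1 := by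
      have := List.head?_reverse (l := (m + 1) :: T)
      rw [hS1pal, List.getLast?_eq_some_getLast (by simp)] at this
      simpa using this.symm
    rw [h2] at h1
    exact h1.symm
  have hY : (List.range ((d + 1) * q + t)).map (runLen p q) =
      [m + 1] ++ (T ++ rep2 d S2 ((m + 1) :: T) ++ S2 ++ ((m + 1) :: T).dropLast) ++
        [m + 1] := by
    rw [← hX]
    nth_rewrite 3 [hlast]
    simp
  have hV := map_runLen_window hdet htq hγ hγβ hγd hγd' he hY
  rw [← hQe, ← hPe] at hV
  rw [CS_eq_map_runLen hQ0 hQ (hP ▸ hQP), ← hP, map_range_rotate (runLen_periodic P hQ0)]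
  have hlen : (d + 1) * q + t ≤ 2 * Q := by rw [hQe]; nlinarith
  have hpre := map_range_prefix (fun j => runLen P Q (e * (Q - 1) + j)) hlen
  rw [hV] at hpre
  simpa using hpre

/-- Lemma 2.5(1): if `k` is even and `[m₁,…,m_k,2n-2] < s < [m₁,…,m_{k-1}]`,
then `CS(s)` contains `(m, S₁ₑ, d⟨S₂,S₁⟩, S₂, S₁_b, m)` as a subsequence, for
some `1 ≤ d ≤ 2n-3`, where `S₁ = (m+1, S₁ₑ) = (S₁_b, m+1)`. -/
theorem statement7
    (M : List ℕ) (m n : ℕ) (r : ℚ)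
    (hMlen : 2 ≤ M.length) (hMpos : ∀ x ∈ M, 0 < x) (hMlast : 2 ≤ M.getLast!)
    (hm : M.head? = some m) (hn : 2 ≤ n) (hr : r = cfQ M)
    (S1 S2 : List ℕ) (hdec : CS r = S1 ++ S2 ++ S1 ++ S2)
    (hS1ne : S1 ≠ []) (hS2ne : S2 ≠ [])
    (hS1pal : S1.reverse = S1) (hS2pal : S2.reverse = S2)
    (hS1h : S1.head? = some (m + 1)) (hS2h : S2.head? = some m)
    (hk : Even M.length) (s : ℚ)
    (hs1 : cfQ (M ++ [2 * n - 2]) < s)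
    (hs2 : s < cfQ M.dropLast) :
    ∃ d : ℕ, 1 ≤ d ∧ d ≤ 2 * n - 3 ∧
      CyclicContains (CS s)
        ([m] ++ S1.tail ++ rep2 d S2 S1 ++ S2 ++ S1.dropLast ++ [m]) := by

  have hMne : M ≠ [] := by rintro rfl; simp at hMlen
  obtain ⟨q, p, t, t', hq, hqp, ht', htq, htp, hM, hD, hN, hdet⟩ :=
    exists_cfQ_convergents M hMne hMpos (by
      rwa [List.getLast!_eq_getLast?_getD, List.getLast?_eq_some_getLast hMne] at hMlast)
  have hdet' : t * p = q * t' + 1 := by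
    rw [hk.neg_one_pow] at hdet
    zify
    linarith
  have hcop : q.Coprime p := by
    rw [← Nat.isCoprime_iff_coprime]
    exact ⟨-t', t, by zify at hdet'; linarith⟩
  have hrq : r = ((q : ℤ) : ℚ) / ((p : ℤ) : ℚ) := by rw [hr, hM]; simp
  have hp : (0 : ℤ) < p := by omega
  have hnum : r.num = q := by rw [hrq]; exact Rat.num_div_eq_of_coprime hp (by simpa using hcop)
  have hden : r.den = p := by
    have := Rat.den_div_eq_of_coprime (a := q) hp (by simpa using hcop)
    rw [← hrq] at this
    exact_mod_cast this
  have hCS := CS_eq_map_runLen hq hnum (hden ▸ hqp)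
  rw [hden, hdec, two_mul, map_range_add_of_periodic (runLen_periodic p hq), List.append_assoc]
    at hCS
  have hS : S1 ++ S2 = (List.range q).map (runLen p q) := by
    have hl := congrArg List.length hCS
    simp only [List.length_append, List.length_map, List.length_range] at hl
    exact List.append_inj_left hCS (by simp; omega)
  rw [hN _ (by omega)] at hs1
  rw [hD] at hs2
  have htt' : t ≤ t' := by nlinarith
  obtain ⟨d, hd1, hdN, hd⟩ := exists_cyclicContains_of_between hq hqp ht' htt' htq hdet'
    (by omega) hs1 hs2 hS hS1ne hS2ne hS1pal hS2pal hS1h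
  exact ⟨d, hd1, by omega, hd⟩

end Heckoid
end
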